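/- arXiv:2109.08797 — 2 statements merged into one kernel-verified Lean document; each statement's English description precedes it below -/
import Mathlib

section
/- Let ω ∈ ℝ with ω ≠ 0, let ψ : ℝ³ → ℝ be infinitely differentiable and let F : ℝ → ℝ be continuously differentiable. If the spherical-coordinate representation Ψ of ψ satisfies (ΔΨ)(φ,θ) = F(Ψ(φ,θ)) − 2ω sin θ for all φ ∈ ℝ and θ ∈ (−π/2, π/2), then ∫₀^{2π} ∫_{−π/2}^{π/2} Ψ(φ,θ) cos φ cos²θ dθ dφ = 0 and ∫₀^{2π} ∫_{−π/2}^{π/2} Ψ(φ,θ) sin φ cos²θ dθ dφ = 0; that is, the projection of ψ onto the first eigenspace of the Laplace–Beltrami operator is a real multiple of sin θ. -/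
open Real MeasureTheory

noncomputable section

/-- The point of the unit sphere with longitude `φ` and latitude `θ`. -/
def sphPt (φ θ : ℝ) : ℝ × ℝ × ℝ :=
  (Real.cos φ * Real.cos θ, Real.sin φ * Real.cos θ, Real.sin θ)

/-- The spherical-coordinate representation of a function `ψ : ℝ³ → ℝ`. -/
def sphRep (ψ : ℝ × ℝ × ℝ → ℝ) (φ θ : ℝ) : ℝ := ψ (sphPt φ θ)

/-- The Laplace–Beltrami operator of the unit sphere in longitude-latitude coordinates:
`(ΔΨ)(φ,θ) = ∂θ²Ψ − tan θ · ∂θΨ + (1/cos²θ) · ∂φ²Ψ`. -/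
def LB (Ψ : ℝ → ℝ → ℝ) (φ θ : ℝ) : ℝ :=
  iteratedDeriv 2 (fun θ' => Ψ φ θ') θ
    - Real.tan θ * deriv (fun θ' => Ψ φ θ') θ
    + (1 / Real.cos θ ^ 2) * iteratedDeriv 2 (fun φ' => Ψ φ' θ) φ

theorem hasDerivAt_fst_slice {f : ℝ × ℝ → ℝ} (hf : ContDiff ℝ 1 f) (x y : ℝ) :
    HasDerivAt (fun s => f (s, y)) (fderiv ℝ f (x, y) (1, 0)) x :=
  ((hf.differentiable one_ne_zero (x, y)).hasFDerivAt).comp_hasDerivAt x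
    ((hasDerivAt_id x).prodMk (hasDerivAt_const x y))

theorem hasDerivAt_snd_slice {f : ℝ × ℝ → ℝ} (hf : ContDiff ℝ 1 f) (x y : ℝ) :
    HasDerivAt (fun t => f (x, t)) (fderiv ℝ f (x, y) (0, 1)) y :=
  ((hf.differentiable one_ne_zero (x, y)).hasFDerivAt).comp_hasDerivAt y
    ((hasDerivAt_const y x).prodMk (hasDerivAt_id y))

/-- The integral over a rectangle of a divergence whose boundary fluxes cancel vanishes. -/
theorem integral_divergence_eq_zero {A B A' B' : ℝ → ℝ → ℝ} {x₀ x₁ y₀ y₁ : ℝ}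
    (hA : ∀ x y, HasDerivAt (fun t => A x t) (A' x y) y)
    (hB : ∀ x y, HasDerivAt (fun s => B s y) (B' x y) x)
    (hA' : Continuous (Function.uncurry A')) (hB' : Continuous (Function.uncurry B'))
    (hAb : ∀ x, A x y₁ = A x y₀) (hBb : ∀ y, B x₁ y = B x₀ y) :
    ∫ x in x₀..x₁, ∫ y in y₀..y₁, (A' x y + B' x y) = 0 := by
  have hAx : ∀ x, Continuous (A' x) := fun x => hA'.comp (Continuous.prodMk_right x)
  have hBx : ∀ x, Continuous (B' x) := fun x => hB'.comp (Continuous.prodMk_right x)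
  have hBy : ∀ y, Continuous (fun x => B' x y) := fun y => hB'.comp (Continuous.prodMk_left y)
  have h₁ : ∀ x, ∫ y in y₀..y₁, (A' x y + B' x y) = ∫ y in y₀..y₁, B' x y := by
    intro x
    rw [intervalIntegral.integral_add ((hAx x).intervalIntegrable _ _)
      ((hBx x).intervalIntegrable _ _), intervalIntegral.integral_eq_sub_of_hasDerivAt
      (fun y _ => hA x y) ((hAx x).intervalIntegrable _ _), hAb, sub_self, zero_add]
  simp_rw [h₁]
  rw [MeasureTheory.intervalIntegral_intervalIntegral_swap]
  · have h₂ : ∀ y, ∫ x in x₀..x₁, B' x y = 0 := by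
      intro y
      rw [intervalIntegral.integral_eq_sub_of_hasDerivAt (fun x _ => hB x y)
        ((hBy y).intervalIntegrable _ _), hBb, sub_self]
    simp [h₂]
  · exact (hB'.continuousOn.integrableOn_compact
      (isCompact_uIcc.prod isCompact_uIcc)).mono_set
        (Set.prod_mono Set.uIoc_subset_uIcc Set.uIoc_subset_uIcc)

/-- The derivative of `ψ` at a point of the sphere in the northward unit direction. -/
def northDeriv (ψ : ℝ × ℝ × ℝ → ℝ) (p : ℝ × ℝ) : ℝ :=
  fderiv ℝ ψ (sphPt p.1 p.2)
    (-(Real.cos p.1 * Real.sin p.2), -(Real.sin p.1 * Real.sin p.2), Real.cos p.2)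

/-- The derivative of `ψ` at a point of the sphere in the eastward unit direction. -/
def eastDeriv (ψ : ℝ × ℝ × ℝ → ℝ) (p : ℝ × ℝ) : ℝ :=
  fderiv ℝ ψ (sphPt p.1 p.2) (-Real.sin p.1, Real.cos p.1, 0)

section

variable {ψ : ℝ × ℝ × ℝ → ℝ}

theorem contDiff_sphPt : ContDiff ℝ (⊤ : ℕ∞) (fun p : ℝ × ℝ => sphPt p.1 p.2) := by
  unfold sphPt
  fun_prop

theorem contDiff_sphRep (hψ : ContDiff ℝ (⊤ : ℕ∞) ψ) :
    ContDiff ℝ (⊤ : ℕ∞) (fun p : ℝ × ℝ => sphRep ψ p.1 p.2) :=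
  hψ.comp contDiff_sphPt

theorem contDiff_fderiv_sphPt (hψ : ContDiff ℝ (⊤ : ℕ∞) ψ) :
    ContDiff ℝ 1 (fun p : ℝ × ℝ => fderiv ℝ ψ (sphPt p.1 p.2)) :=
  (hψ.fderiv_right (m := 1) (by norm_num; exact WithTop.coe_le_coe.2 le_top)).comp
    (contDiff_sphPt.of_le (by exact_mod_cast le_top))

theorem contDiff_northDeriv (hψ : ContDiff ℝ (⊤ : ℕ∞) ψ) : ContDiff ℝ 1 (northDeriv ψ) :=
  (contDiff_fderiv_sphPt hψ).clm_apply (by fun_prop)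

theorem contDiff_eastDeriv (hψ : ContDiff ℝ (⊤ : ℕ∞) ψ) : ContDiff ℝ 1 (eastDeriv ψ) :=
  (contDiff_fderiv_sphPt hψ).clm_apply (by fun_prop)

theorem hasDerivAt_sphRep_latitude (hψ : ContDiff ℝ (⊤ : ℕ∞) ψ) (φ θ : ℝ) :
    HasDerivAt (fun t => sphRep ψ φ t) (northDeriv ψ (φ, θ)) θ := by
  have h : HasDerivAt (fun t => sphPt φ t)
      (-(Real.cos φ * Real.sin θ), -(Real.sin φ * Real.sin θ), Real.cos θ) θ := by
    unfold sphPt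
    convert ((Real.hasDerivAt_cos θ).const_mul (Real.cos φ)).prodMk
      (((Real.hasDerivAt_cos θ).const_mul (Real.sin φ)).prodMk (Real.hasDerivAt_sin θ)) using 1
    simp
  exact (hψ.differentiable (by simp) _).hasFDerivAt.comp_hasDerivAt θ h

theorem hasDerivAt_sphRep_longitude (hψ : ContDiff ℝ (⊤ : ℕ∞) ψ) (φ θ : ℝ) :
    HasDerivAt (fun s => sphRep ψ s θ) (Real.cos θ * eastDeriv ψ (φ, θ)) φ := by
  have h : HasDerivAt (fun s => sphPt s θ)
      (Real.cos θ • (-Real.sin φ, Real.cos φ, (0 : ℝ))) φ := by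
    unfold sphPt
    convert ((Real.hasDerivAt_cos φ).mul_const (Real.cos θ)).prodMk
      (((Real.hasDerivAt_sin φ).mul_const (Real.cos θ)).prodMk
        (hasDerivAt_const φ (Real.sin θ))) using 1
    simp [mul_comm]
  have hcomp := (hψ.differentiable (by simp) (sphPt φ θ)).hasFDerivAt.comp_hasDerivAt φ h
  rwa [map_smul, smul_eq_mul] at hcomp

/-- Symmetry of the mixed second derivatives in longitude-latitude coordinates. -/
theorem fderiv_northDeriv_longitude (hψ : ContDiff ℝ (⊤ : ℕ∞) ψ) (φ θ : ℝ) :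
    fderiv ℝ (northDeriv ψ) (φ, θ) (1, 0) =
      Real.cos θ * fderiv ℝ (eastDeriv ψ) (φ, θ) (0, 1) - Real.sin θ * eastDeriv ψ (φ, θ) := by
  set P : ℝ × ℝ → ℝ := fun p => sphRep ψ p.1 p.2
  have hP : ContDiff ℝ 2 P := (contDiff_sphRep hψ).of_le (WithTop.coe_le_coe.2 le_top)
  have hP₁ : ContDiff ℝ 1 P := hP.of_le (by norm_num)
  have hdP : ContDiff ℝ 1 (fderiv ℝ P) := hP.fderiv_right (by norm_num)
  have hN : northDeriv ψ = fun p => fderiv ℝ P p (0, 1) := by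
    ext ⟨x, y⟩
    exact (hasDerivAt_sphRep_latitude hψ x y).unique (hasDerivAt_snd_slice hP₁ x y)
  have hE : (fun p : ℝ × ℝ => Real.cos p.2 * eastDeriv ψ p) = fun p => fderiv ℝ P p (1, 0) := by
    ext ⟨x, y⟩
    exact (hasDerivAt_sphRep_longitude hψ x y).unique (hasDerivAt_fst_slice hP₁ x y)
  have happ : ∀ v w : ℝ × ℝ, fderiv ℝ (fun p => fderiv ℝ P p v) (φ, θ) w =
      fderiv ℝ (fderiv ℝ P) (φ, θ) w v := by
    intro v w
    rw [fderiv_clm_apply (hdP.differentiable one_ne_zero _) (by fun_prop)]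
    simp
  have hsymm := second_derivative_symmetric
    (fun p => (hP₁.differentiable one_ne_zero p).hasFDerivAt)
    (hdP.differentiable one_ne_zero (φ, θ)).hasFDerivAt ((1 : ℝ), (0 : ℝ)) (0, 1)
  have hcE : ContDiff ℝ 1 (fun p : ℝ × ℝ => Real.cos p.2 * eastDeriv ψ p) :=
    (Real.contDiff_cos.comp contDiff_snd).mul (contDiff_eastDeriv hψ)
  have h := (hasDerivAt_snd_slice hcE φ θ).unique
    ((Real.hasDerivAt_cos θ).mul (hasDerivAt_snd_slice (contDiff_eastDeriv hψ) φ θ))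
  rw [hN, happ, hsymm, ← happ, ← hE, h]
  ring

theorem cos_mul_LB_sphRep (hψ : ContDiff ℝ (⊤ : ℕ∞) ψ) (φ : ℝ) {θ : ℝ} (hθ : Real.cos θ ≠ 0) :
    Real.cos θ * LB (sphRep ψ) φ θ =
      Real.cos θ * fderiv ℝ (northDeriv ψ) (φ, θ) (0, 1) - Real.sin θ * northDeriv ψ (φ, θ)
        + fderiv ℝ (eastDeriv ψ) (φ, θ) (1, 0) := by
  have h₁ : deriv (fun t => sphRep ψ φ t) = fun t => northDeriv ψ (φ, t) :=
    funext fun t => (hasDerivAt_sphRep_latitude hψ φ t).deriv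
  have h₂ : deriv (fun s => sphRep ψ s θ) = fun s => Real.cos θ * eastDeriv ψ (s, θ) :=
    funext fun s => (hasDerivAt_sphRep_longitude hψ s θ).deriv
  have h₃ := (hasDerivAt_snd_slice (contDiff_northDeriv hψ) φ θ).deriv
  have h₄ := ((hasDerivAt_fst_slice (contDiff_eastDeriv hψ) φ θ).const_mul (Real.cos θ)).deriv
  rw [LB, iteratedDeriv_succ, iteratedDeriv_one, iteratedDeriv_succ, iteratedDeriv_one, h₁, h₂,
    h₃, h₄, Real.tan_eq_sin_div_cos]
  field_simp

/-- Pairing the equation with the Killing field of rotations about a horizontal axis, whose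
longitude is determined by `c`. -/
theorem integral_sphRep_mul_sin_add {ω : ℝ} (hω : ω ≠ 0) {F : ℝ → ℝ}
    (hψ : ContDiff ℝ (⊤ : ℕ∞) ψ) (hF : Continuous F)
    (heq : ∀ φ θ : ℝ, θ ∈ Set.Ioo (-(π/2)) (π/2) →
      LB (sphRep ψ) φ θ = F (sphRep ψ φ θ) - 2 * ω * Real.sin θ) (c : ℝ) :
    ∫ φ in (0:ℝ)..(2*π), ∫ θ in (-(π/2))..(π/2),
      sphRep ψ φ θ * Real.sin (φ + c) * Real.cos θ ^ 2 = 0 := by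
  obtain ⟨G, hG⟩ : ∃ G : ℝ → ℝ, ∀ t, HasDerivAt G (F t) t :=
    ⟨fun t => ∫ u in (0:ℝ)..t, F u, fun t => hF.integral_hasStrictDerivAt 0 t |>.hasDerivAt⟩
  have hGc : Continuous G := continuous_iff_continuousAt.2 fun t => (hG t).continuousAt
  have hN := contDiff_northDeriv hψ
  have hE := contDiff_eastDeriv hψ
  have hPc : Continuous (fun p : ℝ × ℝ => sphRep ψ p.1 p.2) := (contDiff_sphRep hψ).continuous
  have hNc := hN.continuous
  have hEc := hE.continuous
  have hdN : ∀ v, Continuous fun p => fderiv ℝ (northDeriv ψ) p v := fun v =>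
    (hN.continuous_fderiv one_ne_zero).clm_apply continuous_const
  have hdE : ∀ v, Continuous fun p => fderiv ℝ (eastDeriv ψ) p v := fun v =>
    (hE.continuous_fderiv one_ne_zero).clm_apply continuous_const
  have hper : ∀ θ, sphPt (2 * π) θ = sphPt 0 θ := fun θ => by simp [sphPt]
  have hPper : ∀ θ, sphRep ψ (2 * π) θ = sphRep ψ 0 θ := fun θ => by simp [sphRep, hper]
  have hNper : ∀ θ, northDeriv ψ (2 * π, θ) = northDeriv ψ (0, θ) := fun θ => by
    simp [northDeriv, hper]
  have hEper : ∀ θ, eastDeriv ψ (2 * π, θ) = eastDeriv ψ (0, θ) := fun θ => by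
    simp [eastDeriv, hper]
  have hs : ∀ φ, HasDerivAt (fun s => Real.sin (s + c)) (Real.cos (φ + c)) φ := fun φ =>
    (Real.hasDerivAt_sin (φ + c)).comp_add_const φ c
  have hk : ∀ φ, HasDerivAt (fun s => Real.cos (s + c)) (-Real.sin (φ + c)) φ := fun φ =>
    (Real.hasDerivAt_cos (φ + c)).comp_add_const φ c
  set P := sphRep ψ
  set a : ℝ → ℝ → ℝ := fun φ θ => northDeriv ψ (φ, θ)
  set b : ℝ → ℝ → ℝ := fun φ θ => eastDeriv ψ (φ, θ)
  set aφ : ℝ → ℝ → ℝ := fun φ θ => fderiv ℝ (northDeriv ψ) (φ, θ) (1, 0)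
  set aθ : ℝ → ℝ → ℝ := fun φ θ => fderiv ℝ (northDeriv ψ) (φ, θ) (0, 1)
  set bφ : ℝ → ℝ → ℝ := fun φ θ => fderiv ℝ (eastDeriv ψ) (φ, θ) (1, 0)
  set bθ : ℝ → ℝ → ℝ := fun φ θ => fderiv ℝ (eastDeriv ψ) (φ, θ) (0, 1)
  have hac : Continuous fun p : ℝ × ℝ => a p.1 p.2 := hNc
  have hbc : Continuous fun p : ℝ × ℝ => b p.1 p.2 := hEc
  have haφc : Continuous fun p : ℝ × ℝ => aφ p.1 p.2 := hdN _
  have haθc : Continuous fun p : ℝ × ℝ => aθ p.1 p.2 := hdN _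
  have hbφc : Continuous fun p : ℝ × ℝ => bφ p.1 p.2 := hdE _
  have hbθc : Continuous fun p : ℝ × ℝ => bθ p.1 p.2 := hdE _
  have hPθ : ∀ φ θ, HasDerivAt (fun t => P φ t) (a φ θ) θ := hasDerivAt_sphRep_latitude hψ
  have hPφ : ∀ φ θ, HasDerivAt (fun s => P s θ) (Real.cos θ * b φ θ) φ :=
    hasDerivAt_sphRep_longitude hψ
  have hDaθ : ∀ φ θ, HasDerivAt (fun t => a φ t) (aθ φ θ) θ := hasDerivAt_snd_slice hN
  have hDaφ : ∀ φ θ, HasDerivAt (fun s => a s θ) (aφ φ θ) φ := hasDerivAt_fst_slice hN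
  have hDbθ : ∀ φ θ, HasDerivAt (fun t => b φ t) (bθ φ θ) θ := hasDerivAt_snd_slice hE
  have hDbφ : ∀ φ θ, HasDerivAt (fun s => b s θ) (bφ φ θ) φ := hasDerivAt_fst_slice hE
  have hmix : ∀ φ θ, aφ φ θ = Real.cos θ * bθ φ θ - Real.sin θ * b φ θ :=
    fderiv_northDeriv_longitude hψ
  -- `X` is the derivative of `ψ` along the Killing field.
  set X : ℝ → ℝ → ℝ := fun φ θ =>
    Real.sin (φ + c) * a φ θ - Real.sin θ * Real.cos (φ + c) * b φ θ with hX
  set Xθ : ℝ → ℝ → ℝ := fun φ θ => Real.sin (φ + c) * aθ φ θ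
    - Real.cos (φ + c) * (Real.cos θ * b φ θ + Real.sin θ * bθ φ θ) with hXθ
  set Xφ : ℝ → ℝ → ℝ := fun φ θ => Real.cos (φ + c) * a φ θ + Real.sin (φ + c) * aφ φ θ
    - Real.sin θ * (-Real.sin (φ + c) * b φ θ + Real.cos (φ + c) * bφ φ θ) with hXφ
  have hXc : Continuous fun p : ℝ × ℝ => X p.1 p.2 := by simp only [hX]; fun_prop
  have hXθc : Continuous fun p : ℝ × ℝ => Xθ p.1 p.2 := by simp only [hXθ]; fun_prop
  have hXφc : Continuous fun p : ℝ × ℝ => Xφ p.1 p.2 := by simp only [hXφ]; fun_prop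
  have hDXθ : ∀ φ θ, HasDerivAt (fun t => X φ t) (Xθ φ θ) θ := fun φ θ =>
    HasDerivAt.congr_deriv (((hDaθ φ θ).const_mul (Real.sin (φ + c))).sub
      (((Real.hasDerivAt_sin θ).mul_const (Real.cos (φ + c))).mul (hDbθ φ θ)))
      (by simp only [hXθ]; ring)
  have hDXφ : ∀ φ θ, HasDerivAt (fun s => X s θ) (Xφ φ θ) φ := fun φ θ =>
    HasDerivAt.congr_deriv (((hs φ).mul (hDaφ φ θ)).sub
      (((hk φ).const_mul (Real.sin θ)).mul (hDbφ φ θ)))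
      (by simp only [hXφ]; ring)
  have key := integral_divergence_eq_zero (x₀ := 0) (x₁ := 2 * π) (y₀ := -(π/2)) (y₁ := π/2)
    (A := fun φ θ => Real.cos θ * (a φ θ * X φ θ
      - (a φ θ * a φ θ + b φ θ * b φ θ) * (Real.sin (φ + c) / 2)
      - G (P φ θ) * Real.sin (φ + c) + P φ θ * Real.sin θ * (2 * ω * Real.sin (φ + c))))
    (A' := fun φ θ => -Real.sin θ * (a φ θ * X φ θ
      - (a φ θ * a φ θ + b φ θ * b φ θ) * (Real.sin (φ + c) / 2)
      - G (P φ θ) * Real.sin (φ + c) + P φ θ * Real.sin θ * (2 * ω * Real.sin (φ + c)))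
      + Real.cos θ * (aθ φ θ * X φ θ + a φ θ * Xθ φ θ
      - (aθ φ θ * a φ θ + a φ θ * aθ φ θ + (bθ φ θ * b φ θ + b φ θ * bθ φ θ))
        * (Real.sin (φ + c) / 2)
      - F (P φ θ) * a φ θ * Real.sin (φ + c)
      + (a φ θ * Real.sin θ + P φ θ * Real.cos θ) * (2 * ω * Real.sin (φ + c))))
    (B := fun φ θ => b φ θ * X φ θ
      + ((a φ θ * a φ θ + b φ θ * b φ θ) / 2 + G (P φ θ) - P φ θ * (2 * ω * Real.sin θ))
        * (Real.sin θ * Real.cos (φ + c)))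
    (B' := fun φ θ => bφ φ θ * X φ θ + b φ θ * Xφ φ θ
      + (((aφ φ θ * a φ θ + a φ θ * aφ φ θ + (bφ φ θ * b φ θ + b φ θ * bφ φ θ)) / 2
        + F (P φ θ) * (Real.cos θ * b φ θ) - Real.cos θ * b φ θ * (2 * ω * Real.sin θ))
        * (Real.sin θ * Real.cos (φ + c))
      + ((a φ θ * a φ θ + b φ θ * b φ θ) / 2 + G (P φ θ) - P φ θ * (2 * ω * Real.sin θ))
        * (Real.sin θ * -Real.sin (φ + c))))
    (fun φ θ => (Real.hasDerivAt_cos θ).mul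
      (((((hDaθ φ θ).mul (hDXθ φ θ)).sub ((((hDaθ φ θ).mul (hDaθ φ θ)).add
        ((hDbθ φ θ).mul (hDbθ φ θ))).mul_const _)).sub
        (((hG (P φ θ)).comp θ (hPθ φ θ)).mul_const _)).add
        (((hPθ φ θ).mul (Real.hasDerivAt_sin θ)).mul_const _)))
    (fun φ θ => ((hDbφ φ θ).mul (hDXφ φ θ)).add
      (((((((hDaφ φ θ).mul (hDaφ φ θ)).add ((hDbφ φ θ).mul (hDbφ φ θ))).div_const 2).add
        ((hG (P φ θ)).comp φ (hPφ φ θ))).sub ((hPφ φ θ).mul_const _)).mul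
        ((hk φ).const_mul (Real.sin θ))))
    (by simp only [Function.uncurry_def]; fun_prop)
    (by simp only [Function.uncurry_def]; fun_prop)
    (fun φ => by simp)
    (fun θ => by
      have h₁ : a (2 * π) θ = a 0 θ := hNper θ
      have h₂ : b (2 * π) θ = b 0 θ := hEper θ
      have h₃ : Real.sin (2 * π + c) = Real.sin (0 + c) := by
        rw [zero_add, add_comm, Real.sin_add_two_pi]
      have h₄ : Real.cos (2 * π + c) = Real.cos (0 + c) := by
        rw [zero_add, add_comm, Real.cos_add_two_pi]
      simp only [hX, h₁, h₂, h₃, h₄, hPper θ])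
  have hint : ∫ φ in (0:ℝ)..(2*π), ∫ θ in (-(π/2))..(π/2),
      2 * ω * (P φ θ * Real.sin (φ + c) * Real.cos θ ^ 2) = 0 := by
    refine Eq.trans ?_ key
    refine intervalIntegral.integral_congr fun φ _ =>
      intervalIntegral.integral_congr_Ioo_of_le (by linarith [Real.pi_pos]) fun θ hθ => ?_
    have h : Real.cos θ * LB P φ θ =
        Real.cos θ * aθ φ θ - Real.sin θ * a φ θ + bφ φ θ :=
      cos_mul_LB_sphRep hψ φ (Real.cos_pos_of_mem_Ioo hθ).ne'
    rw [heq φ θ hθ] at h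
    simp only [hX, hXθ, hXφ, hmix]
    linear_combination (Real.sin (φ + c) * a φ θ - Real.sin θ * Real.cos (φ + c) * b φ θ) * h
      + a φ θ * b φ θ * Real.cos (φ + c) * Real.sin_sq_add_cos_sq θ
  simp only [intervalIntegral.integral_const_mul] at hint
  exact (mul_eq_zero.1 hint).resolve_left (by simpa using hω)

end

/-- For `ω ≠ 0`, any solution of `ΔΨ = F(Ψ) − 2ω sin θ` has degree-one projection which is a
multiple of `sin θ`: the components along `cos φ cos θ` and `sin φ cos θ` vanish. -/
theorem projection_onto_first_eigenspace (ω : ℝ) (hω : ω ≠ 0)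
    (ψ : ℝ × ℝ × ℝ → ℝ) (F : ℝ → ℝ)
    (hψ : ContDiff ℝ (⊤ : ℕ∞) ψ) (hF : ContDiff ℝ 1 F)
    (heq : ∀ φ θ : ℝ, θ ∈ Set.Ioo (-(π/2)) (π/2) →
      LB (sphRep ψ) φ θ = F (sphRep ψ φ θ) - 2 * ω * Real.sin θ) :
    (∫ φ in (0:ℝ)..(2*π), ∫ θ in (-(π/2))..(π/2),
        sphRep ψ φ θ * Real.cos φ * Real.cos θ ^ 2) = 0 ∧
    (∫ φ in (0:ℝ)..(2*π), ∫ θ in (-(π/2))..(π/2),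
        sphRep ψ φ θ * Real.sin φ * Real.cos θ ^ 2) = 0 := by
  have h := integral_sphRep_mul_sin_add hω hψ hF.continuous heq
  refine ⟨?_, by simpa using h 0⟩
  simpa [Real.sin_add_pi_div_two] using h (π / 2)
end
end

section
/- Let ω ∈ ℝ with ω ≠ 0, let ψ : ℝ³ → ℝ be infinitely differentiable and let F : ℝ → ℝ be continuously differentiable with F'(s) > −6 for every s ∈ ℝ. If the spherical-coordinate representation Ψ of ψ satisfies (ΔΨ)(φ,θ) = F(Ψ(φ,θ)) − 2ω sin θ for all φ ∈ ℝ and θ ∈ (−π/2, π/2), then ψ is zonal: there exists g : ℝ → ℝ such that ψ(x) = g(x₃) for every x = (x₁,x₂,x₃) in the unit sphere S², equivalently Ψ(φ,θ) is independent of φ. -/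
open Real MeasureTheory

noncomputable section

theorem norm_sq_fourierCoeffOn_ofReal (f : ℝ → ℝ) (hf : Continuous f) (n : ℤ) :
    ‖fourierCoeffOn Real.two_pi_pos (fun x => (f x : ℂ)) n‖ ^ 2 = (1 / (2 * π)) ^ 2 *
      ((∫ x in (0 : ℝ)..2 * π, f x * cos (n * x)) ^ 2
        + (∫ x in (0 : ℝ)..2 * π, f x * sin (n * x)) ^ 2) := by
  have key : (∫ x in (0 : ℝ)..2 * π,
      fourier (-n) (x : AddCircle (2 * π - 0)) • (f x : ℂ)) =
      ((∫ x in (0 : ℝ)..2 * π, f x * cos (n * x) : ℝ) : ℂ)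
        - ((∫ x in (0 : ℝ)..2 * π, f x * sin (n * x) : ℝ) : ℂ) * Complex.I := by
    rw [← intervalIntegral.integral_ofReal, ← intervalIntegral.integral_ofReal,
      ← intervalIntegral.integral_mul_const, ← intervalIntegral.integral_sub]
    · refine intervalIntegral.integral_congr fun x _ => ?_
      have h : 2 * (π : ℂ) * Complex.I * ((-n : ℤ) : ℂ) * (x : ℂ) / ((2 * π - 0 : ℝ) : ℂ)
          = ((-(n * x) : ℝ) : ℂ) * Complex.I := by
        have : (π : ℂ) ≠ 0 := by exact_mod_cast Real.pi_ne_zero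
        push_cast
        field_simp
        ring
      simp only [fourier_coe_apply, smul_eq_mul]
      rw [h, Complex.exp_mul_I, ← Complex.ofReal_cos, ← Complex.ofReal_sin, Real.cos_neg,
        Real.sin_neg]
      push_cast
      ring
    · exact Continuous.intervalIntegrable (by fun_prop) _ _
    · exact Continuous.intervalIntegrable (by fun_prop) _ _
  rw [fourierCoeffOn_eq_integral, key, norm_smul, mul_pow, sub_zero, ← Complex.normSq_eq_norm_sq,
    sub_eq_add_neg, ← neg_mul, ← Complex.ofReal_neg, Complex.normSq_add_mul_I, Real.norm_eq_abs,
    sq_abs, neg_sq]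

theorem wirtinger_second_mode {f f' : ℝ → ℝ} (hf : ∀ x, HasDerivAt f (f' x) x)
    (hf' : Continuous f') (hper : f (2 * π) = f 0) (hmean : ∫ x in (0 : ℝ)..2 * π, f x = 0) :
    4 * (∫ x in (0 : ℝ)..2 * π, f x ^ 2)
      - 3 / π * ((∫ x in (0 : ℝ)..2 * π, f x * cos x) ^ 2
        + (∫ x in (0 : ℝ)..2 * π, f x * sin x) ^ 2)
      ≤ ∫ x in (0 : ℝ)..2 * π, f' x ^ 2 := by
  have hfc : Continuous f := continuous_iff_continuousAt.2 fun x => (hf x).continuousAt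
  have parseval : ∀ g : ℝ → ℝ, Continuous g →
      HasSum (fun n => ‖fourierCoeffOn Real.two_pi_pos (fun x => (g x : ℂ)) n‖ ^ 2)
        ((2 * π)⁻¹ * ∫ x in (0 : ℝ)..2 * π, g x ^ 2) := by
    intro g hg
    have hL2 : MemLp (fun x => (g x : ℂ)) 2 (volume.restrict (Set.Ioc 0 (2 * π))) := by
      have hc : Continuous fun x => (g x : ℂ) := by fun_prop
      refine ((memLp_two_iff_integrable_sq_norm hc.aestronglyMeasurable).2 ?_)
      exact ((hc.norm.pow 2).integrableOn_Icc (a := 0) (b := 2 * π)).mono_set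
        Set.Ioc_subset_Icc_self
    simpa using hasSum_sq_fourierCoeffOn Real.two_pi_pos hL2
  have hcoeff : ∀ n : ℤ, ‖fourierCoeffOn Real.two_pi_pos (fun x => (f' x : ℂ)) n‖ ^ 2
      = (n : ℝ) ^ 2 * ‖fourierCoeffOn Real.two_pi_pos (fun x => (f x : ℂ)) n‖ ^ 2 := by
    intro n
    rcases eq_or_ne n 0 with rfl | hn
    · rw [norm_sq_fourierCoeffOn_ofReal f' hf']
      have : ∫ x in (0 : ℝ)..2 * π, f' x = 0 := by
        rw [intervalIntegral.integral_eq_sub_of_hasDerivAt (fun x _ => hf x)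
          (hf'.intervalIntegrable _ _), hper, sub_self]
      simp [this]
    · have h := fourierCoeffOn_of_hasDerivAt Real.two_pi_pos (f := fun x => (f x : ℂ))
        (f' := fun x => (f' x : ℂ)) hn (fun x _ => (hf x).ofReal_comp)
        (Continuous.intervalIntegrable (by fun_prop) _ _)
      rw [h, hper, norm_mul, mul_pow]
      have hn' : (n : ℝ) ≠ 0 := by exact_mod_cast hn
      have hpi := Real.pi_pos
      simp [mul_pow, abs_of_pos hpi]
      field_simp
  have hsum := ((parseval f' hf').sub ((parseval f hfc).mul_left 4))
  have hle := sum_le_hasSum {0, 1, -1} (fun n hn => ?_) hsum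
  · simp only [hcoeff, norm_sq_fourierCoeffOn_ofReal f hfc] at hle
    rw [Finset.sum_insert (by decide), Finset.sum_insert (by decide), Finset.sum_singleton] at hle
    simp [hmean] at hle
    have hpi := Real.pi_pos
    have := mul_le_mul_of_nonneg_left hle Real.two_pi_pos.le
    field_simp at this ⊢
    linarith
  · rw [hcoeff, ← sub_mul]
    refine mul_nonneg ?_ (sq_nonneg _)
    simp only [Finset.mem_insert, Finset.mem_singleton, not_or] at hn
    have : 4 ≤ n ^ 2 := by
      have : 2 ≤ |n| := by
        obtain ⟨h0, h1, h2⟩ := hn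
        rcases abs_cases n with h | h <;> omega
      nlinarith [sq_abs n]
    have : (4 : ℝ) ≤ (n : ℝ) ^ 2 := by exact_mod_cast this
    linarith

theorem bessel_first_mode {f : ℝ → ℝ} (hf : Continuous f) :
    1 / π * ((∫ x in (0 : ℝ)..2 * π, f x * cos x) ^ 2
        + (∫ x in (0 : ℝ)..2 * π, f x * sin x) ^ 2)
      ≤ ∫ x in (0 : ℝ)..2 * π, f x ^ 2 := by
  set A := ∫ x in (0 : ℝ)..2 * π, f x * cos x with hA
  set B := ∫ x in (0 : ℝ)..2 * π, f x * sin x with hB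
  have hpi := Real.pi_pos
  have hnn : 0 ≤ ∫ x in (0 : ℝ)..2 * π, (f x - (A * cos x + B * sin x) / π) ^ 2 :=
    intervalIntegral.integral_nonneg Real.two_pi_pos.le fun _ _ => sq_nonneg _
  have hexp : ∫ x in (0 : ℝ)..2 * π, (f x - (A * cos x + B * sin x) / π) ^ 2
      = (∫ x in (0 : ℝ)..2 * π, f x ^ 2) - 2 * A / π * A - 2 * B / π * B
        + A ^ 2 / π ^ 2 * (∫ x in (0 : ℝ)..2 * π, cos x ^ 2)
        + B ^ 2 / π ^ 2 * (∫ x in (0 : ℝ)..2 * π, sin x ^ 2)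
        + 2 * A * B / π ^ 2 * ∫ x in (0 : ℝ)..2 * π, sin x * cos x := by
    have hrw : ∀ x, (f x - (A * cos x + B * sin x) / π) ^ 2 = f x ^ 2 - 2 * A / π * (f x * cos x)
        - 2 * B / π * (f x * sin x) + A ^ 2 / π ^ 2 * cos x ^ 2 + B ^ 2 / π ^ 2 * sin x ^ 2
        + 2 * A * B / π ^ 2 * (sin x * cos x) := fun x => by field_simp; ring
    simp_rw [hrw]
    rw [intervalIntegral.integral_add, intervalIntegral.integral_add,
      intervalIntegral.integral_add, intervalIntegral.integral_sub,
      intervalIntegral.integral_sub]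
    · simp only [intervalIntegral.integral_const_mul, ← hA, ← hB]
    all_goals exact Continuous.intervalIntegrable (by fun_prop) _ _
  rw [hexp, integral_cos_sq, integral_sin_sq, integral_sin_mul_cos₁] at hnn
  simp at hnn
  field_simp at hnn ⊢
  linarith

theorem hardy_half {d d' : ℝ → ℝ} (hd : ∀ x, HasDerivAt d (d' x) x) (hd' : Continuous d')
    (h0 : d 0 = 0) :
    0 ≤ ∫ x in (0 : ℝ)..π / 2, cos x ^ 3 * (d' x ^ 2 - 4 * d x ^ 2) := by
  have hdc : Continuous d := continuous_iff_continuousAt.2 fun x => (hd x).continuousAt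
  have hsin : ∀ x ∈ Set.Ioc 0 (π / 2), sin x ≠ 0 := fun x hx =>
    (sin_pos_of_pos_of_lt_pi hx.1 (by linarith [hx.2, Real.pi_pos])).ne'
  have hcont : ContinuousOn (fun x => cos x ^ 4 * d x * (d x / sin x)) (Set.Icc 0 (π / 2)) := by
    intro x hx
    rcases hx.1.eq_or_lt with rfl | hx0
    · refine ContinuousAt.continuousWithinAt (continuousAt_iff_punctured_nhds.2 ?_)
      have h1 := hasDerivAt_iff_tendsto_slope.1 (hd 0)
      have h2 := hasDerivAt_iff_tendsto_slope.1 (hasDerivAt_sin 0)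
      rw [cos_zero] at h2
      have h3 : Filter.Tendsto (fun x => cos x ^ 4 * d x) (nhdsWithin 0 {0}ᶜ) (nhds 0) := by
        have : Continuous fun x => cos x ^ 4 * d x := by fun_prop
        simpa [h0] using (this.tendsto 0).mono_left nhdsWithin_le_nhds
      have h4 := h3.mul (h1.div h2 one_ne_zero)
      rw [zero_mul] at h4
      simp only [h0, mul_zero, zero_mul]
      refine h4.congr' ?_
      filter_upwards [self_mem_nhdsWithin] with y hy
      have hy : y ≠ 0 := hy
      simp only [Pi.div_apply, slope_def_field, h0, sin_zero, sub_zero]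
      rw [div_div_div_cancel_right₀ hy]
    · exact ContinuousAt.continuousWithinAt ((by fun_prop : Continuous
        fun x => cos x ^ 4 * d x).continuousAt.mul
          (hdc.continuousAt.div continuous_sin.continuousAt (hsin x ⟨hx0, hx.2⟩)))
  have hle := intervalIntegral.sub_le_integral_of_hasDeriv_right_of_le (by positivity) hcont
    (g' := fun x => ((4 * cos x ^ 3 * (-sin x)) * d x + cos x ^ 4 * d' x) * (d x / sin x)
      + cos x ^ 4 * d x * ((d' x * sin x - d x * cos x) / sin x ^ 2))
    (φ := fun x => cos x ^ 3 * (d' x ^ 2 - 4 * d x ^ 2)) ?_ ?_ ?_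
  · simpa [h0] using hle
  · intro x hx
    have h := ((((hasDerivAt_cos x).fun_pow 4).fun_mul (hd x)).fun_mul
      ((hd x).fun_div (hasDerivAt_sin x) (hsin x ⟨hx.1, hx.2.le⟩)))
    exact (h.congr_deriv (by norm_num)).hasDerivWithinAt
  · exact Continuous.integrableOn_Icc (by fun_prop)
  · intro x hx
    have hs := hsin x ⟨hx.1, hx.2.le⟩
    have hc : 0 ≤ cos x := cos_nonneg_of_mem_Icc ⟨by linarith [hx.1, Real.pi_pos], hx.2.le⟩
    have : 0 ≤ cos x ^ 3 * (d' x - cos x * d x / sin x) ^ 2 := by positivity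
    refine le_of_sub_nonneg (this.trans_eq ?_)
    field_simp
    ring

theorem hardy_full {d d' : ℝ → ℝ} (hd : ∀ x, HasDerivAt d (d' x) x) (hd' : Continuous d')
    (h0 : d 0 = 0) :
    0 ≤ ∫ x in (-(π / 2))..π / 2, cos x ^ 3 * (d' x ^ 2 - 4 * d x ^ 2) := by
  have hdc : Continuous d := continuous_iff_continuousAt.2 fun x => (hd x).continuousAt
  have h1 := hardy_half hd hd' h0
  have h2 := hardy_half (d := fun x => d (-x)) (d' := fun x => -d' (-x))
    (fun x => ((hd (-x)).comp x (hasDerivAt_neg x)).congr_deriv (by ring)) (by fun_prop)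
    (by simpa using h0)
  have h3 := intervalIntegral.integral_comp_neg (a := 0) (b := π / 2)
    (fun x => cos x ^ 3 * (d' x ^ 2 - 4 * d x ^ 2))
  simp only [cos_neg, neg_zero] at h3
  simp only [neg_sq, h3] at h2
  rw [← intervalIntegral.integral_add_adjacent_intervals (b := 0)
    (Continuous.intervalIntegrable (by fun_prop) _ _)
    (Continuous.intervalIntegrable (by fun_prop) _ _)]
  exact add_nonneg h2 h1

theorem first_mode_energy_nonneg {c c' : ℝ → ℝ} (hc : ∀ x, HasDerivAt c (c' x) x)
    (hc' : Continuous c') (hmean : ∫ x in (-(π / 2))..π / 2, cos x ^ 3 * c x = 0) :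
    0 ≤ ∫ x in (-(π / 2))..π / 2, cos x * ((cos x * c' x + sin x * c x) ^ 2 - 3 * c x ^ 2) := by
  have hcc : Continuous c := continuous_iff_continuousAt.2 fun x => (hc x).continuousAt
  have h1 := hardy_full (fun x => (hc x).sub_const (c 0)) hc' (sub_self _)
  have h2 : ∫ x in (-(π / 2))..π / 2, (3 * cos x ^ 3 - 2 * cos x) * c x ^ 2
      + sin x * cos x ^ 2 * (2 * c x * c' x) = 0 := by
    rw [intervalIntegral.integral_eq_sub_of_hasDerivAt
      (f := fun x => sin x * cos x ^ 2 * c x ^ 2)]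
    · simp
    · intro x _
      have h := ((hasDerivAt_sin x).fun_mul ((hasDerivAt_cos x).fun_pow 2)).fun_mul
        ((hc x).fun_pow 2)
      refine h.congr_deriv ?_
      push_cast
      linear_combination (-2 * c x ^ 2 * cos x) * sin_sq x
    · exact Continuous.intervalIntegrable (by fun_prop) _ _
  have hpos : 0 ≤ ∫ x in (-(π / 2))..π / 2, cos x ^ 3 :=
    intervalIntegral.integral_nonneg (by linarith [Real.pi_pos]) fun x hx =>
      pow_nonneg (cos_nonneg_of_mem_Icc hx) 3
  have h3 : ∫ x in (-(π / 2))..π / 2, cos x * ((cos x * c' x + sin x * c x) ^ 2 - 3 * c x ^ 2)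
      = (∫ x in (-(π / 2))..π / 2, cos x ^ 3 * (c' x ^ 2 - 4 * (c x - c 0) ^ 2))
        + (∫ x in (-(π / 2))..π / 2, (3 * cos x ^ 3 - 2 * cos x) * c x ^ 2
      + sin x * cos x ^ 2 * (2 * c x * c' x))
      - 8 * c 0 * (∫ x in (-(π / 2))..π / 2, cos x ^ 3 * c x)
      + 4 * c 0 ^ 2 * ∫ x in (-(π / 2))..π / 2, cos x ^ 3 := by
    rw [← intervalIntegral.integral_const_mul, ← intervalIntegral.integral_const_mul,
      ← intervalIntegral.integral_add, ← intervalIntegral.integral_sub,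
      ← intervalIntegral.integral_add]
    · refine intervalIntegral.integral_congr fun x _ => ?_
      linear_combination (cos x * c x ^ 2) * sin_sq x
    all_goals exact Continuous.intervalIntegrable (by fun_prop) _ _
  rw [h3, h2, hmean]
  have := mul_nonneg (by positivity : 0 ≤ 4 * c 0 ^ 2) hpos
  linarith

/-- The derivative in the first variable (the longitude). -/
def dLon (f : ℝ → ℝ → ℝ) (φ θ : ℝ) : ℝ := deriv (fun s => f s θ) φ

/-- The derivative in the second variable (the latitude). -/
def dLat (f : ℝ → ℝ → ℝ) (φ θ : ℝ) : ℝ := deriv (fun s => f φ s) θ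

section PartialDerivatives

variable {f : ℝ → ℝ → ℝ}

theorem hasDerivAt_fderiv_lon (hf : Differentiable ℝ (Function.uncurry f)) (φ θ : ℝ) :
    HasDerivAt (fun s => f s θ) (fderiv ℝ (Function.uncurry f) (φ, θ) (1, 0)) φ :=
  (hf (φ, θ)).hasFDerivAt.comp_hasDerivAt (f := fun s => (s, θ)) φ
    ((hasDerivAt_id' φ).prodMk (hasDerivAt_const φ θ))

theorem hasDerivAt_fderiv_lat (hf : Differentiable ℝ (Function.uncurry f)) (φ θ : ℝ) :
    HasDerivAt (fun s => f φ s) (fderiv ℝ (Function.uncurry f) (φ, θ) (0, 1)) θ :=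
  (hf (φ, θ)).hasFDerivAt.comp_hasDerivAt (f := fun s => (φ, s)) θ
    ((hasDerivAt_const θ φ).prodMk (hasDerivAt_id' θ))

theorem uncurry_dLon (hf : Differentiable ℝ (Function.uncurry f)) :
    Function.uncurry (dLon f) = fun x => fderiv ℝ (Function.uncurry f) x (1, 0) :=
  funext fun x => (hasDerivAt_fderiv_lon hf x.1 x.2).deriv

theorem uncurry_dLat (hf : Differentiable ℝ (Function.uncurry f)) :
    Function.uncurry (dLat f) = fun x => fderiv ℝ (Function.uncurry f) x (0, 1) :=
  funext fun x => (hasDerivAt_fderiv_lat hf x.1 x.2).deriv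

theorem ContDiff.dLon (hf : ContDiff ℝ (⊤ : ℕ∞) (Function.uncurry f)) :
    ContDiff ℝ (⊤ : ℕ∞) (Function.uncurry (dLon f)) := by
  rw [uncurry_dLon (hf.differentiable (by simp))]
  exact (hf.fderiv_right (m := (⊤ : ℕ∞)) (by simp)).clm_apply contDiff_const

theorem ContDiff.dLat (hf : ContDiff ℝ (⊤ : ℕ∞) (Function.uncurry f)) :
    ContDiff ℝ (⊤ : ℕ∞) (Function.uncurry (dLat f)) := by
  rw [uncurry_dLat (hf.differentiable (by simp))]
  exact (hf.fderiv_right (m := (⊤ : ℕ∞)) (by simp)).clm_apply contDiff_const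

theorem hasDerivAt_dLon (hf : ContDiff ℝ (⊤ : ℕ∞) (Function.uncurry f)) (φ θ : ℝ) :
    HasDerivAt (fun s => f s θ) (dLon f φ θ) φ :=
  (hasDerivAt_fderiv_lon (hf.differentiable (by simp)) φ θ).differentiableAt.hasDerivAt

theorem hasDerivAt_dLat (hf : ContDiff ℝ (⊤ : ℕ∞) (Function.uncurry f)) (φ θ : ℝ) :
    HasDerivAt (fun s => f φ s) (dLat f φ θ) θ :=
  (hasDerivAt_fderiv_lat (hf.differentiable (by simp)) φ θ).differentiableAt.hasDerivAt

theorem dLon_dLat_comm (hf : ContDiff ℝ (⊤ : ℕ∞) (Function.uncurry f)) (φ θ : ℝ) :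
    dLon (dLat f) φ θ = dLat (dLon f) φ θ := by
  have hd : Differentiable ℝ (Function.uncurry f) := hf.differentiable (by simp)
  have hd' : Differentiable ℝ (fderiv ℝ (Function.uncurry f)) :=
    (hf.fderiv_right (m := (⊤ : ℕ∞)) (by simp)).differentiable (by simp)
  have h1 := hasDerivAt_fderiv_lon (f := dLat f) (hf.dLat.differentiable (by simp)) φ θ
  have h2 := hasDerivAt_fderiv_lat (f := dLon f) (hf.dLon.differentiable (by simp)) φ θ
  have hsymm : IsSymmSndFDerivAt ℝ (Function.uncurry f) (φ, θ) :=
    hf.contDiffAt.isSymmSndFDerivAt (by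
      rw [minSmoothness_of_isRCLikeNormedField]
      exact WithTop.coe_le_coe.2 (le_top : (2 : ℕ∞) ≤ ⊤))
  rw [dLon, dLat, h1.deriv, h2.deriv, uncurry_dLat hd, uncurry_dLon hd,
    fderiv_clm_apply (hd' _) (by fun_prop), fderiv_clm_apply (hd' _) (by fun_prop)]
  simpa using hsymm.eq (1, 0) (0, 1)

end PartialDerivatives

theorem integral_divergence_eq_zero_s3 {N₁ N₂ n₁ n₂ t : ℝ → ℝ → ℝ}
    (h₁ : ∀ φ θ, HasDerivAt (fun s => N₁ s θ) (n₁ φ θ) φ)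
    (h₂ : ∀ φ θ, HasDerivAt (fun s => N₂ φ s) (n₂ φ θ) θ)
    (hc₁ : Continuous (Function.uncurry n₁)) (hc₂ : Continuous (Function.uncurry n₂))
    (hper : ∀ θ, N₁ (2 * π) θ = N₁ 0 θ) (hpole : ∀ φ, N₂ φ (π / 2) = N₂ φ (-(π / 2)))
    (ht : ∀ φ, ∀ θ ∈ Set.Icc (-(π / 2)) (π / 2), n₁ φ θ + n₂ φ θ = t φ θ) :
    ∫ θ in (-(π / 2))..π / 2, ∫ φ in (0 : ℝ)..2 * π, t φ θ = 0 := by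
  have hi₁ : ∀ θ, ∫ φ in (0 : ℝ)..2 * π, n₁ φ θ = 0 := fun θ => by
    rw [intervalIntegral.integral_eq_sub_of_hasDerivAt (fun x _ => h₁ x θ)
      (Continuous.intervalIntegrable (by fun_prop) _ _), hper, sub_self]
  have hi₂ : ∀ φ, ∫ θ in (-(π / 2))..π / 2, n₂ φ θ = 0 := fun φ => by
    rw [intervalIntegral.integral_eq_sub_of_hasDerivAt (fun x _ => h₂ φ x)
      (Continuous.intervalIntegrable (by fun_prop) _ _), hpole, sub_self]
  have hswap : ∫ θ in (-(π / 2))..π / 2, ∫ φ in (0 : ℝ)..2 * π, n₂ φ θ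
      = ∫ φ in (0 : ℝ)..2 * π, ∫ θ in (-(π / 2))..π / 2, n₂ φ θ := by
    refine intervalIntegral_intervalIntegral_swap (F := fun θ φ => n₂ φ θ) ?_
    refine IntegrableOn.mono_set (t := Set.uIcc (-(π / 2)) (π / 2) ×ˢ Set.uIcc 0 (2 * π)) ?_
      (Set.prod_mono Set.uIoc_subset_uIcc Set.uIoc_subset_uIcc)
    exact ContinuousOn.integrableOn_compact (isCompact_uIcc.prod isCompact_uIcc)
      (Continuous.continuousOn (by fun_prop))
  have hle : -(π / 2) ≤ π / 2 := by linarith [Real.pi_pos]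
  calc ∫ θ in (-(π / 2))..π / 2, ∫ φ in (0 : ℝ)..2 * π, t φ θ
      = ∫ θ in (-(π / 2))..π / 2, ∫ φ in (0 : ℝ)..2 * π, n₂ φ θ := by
        refine intervalIntegral.integral_congr fun θ hθ => ?_
        rw [Set.uIcc_of_le hle] at hθ
        have : ∫ φ in (0 : ℝ)..2 * π, t φ θ = ∫ φ in (0 : ℝ)..2 * π, (n₁ φ θ + n₂ φ θ) :=
          intervalIntegral.integral_congr fun φ _ => (ht φ θ hθ).symm
        simp only [this]
        rw [intervalIntegral.integral_add (Continuous.intervalIntegrable (by fun_prop) _ _)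
          (Continuous.intervalIntegrable (by fun_prop) _ _), hi₁, zero_add]
    _ = 0 := by simp [hswap, hi₂]

theorem hasDerivAt_integral_of_continuous {f f' : ℝ → ℝ → ℝ} {a b : ℝ}
    (hf : Continuous (Function.uncurry f)) (hf' : Continuous (Function.uncurry f'))
    (h : ∀ φ θ, HasDerivAt (fun s => f φ s) (f' φ θ) θ) (θ : ℝ) :
    HasDerivAt (fun s => ∫ φ in a..b, f φ s) (∫ φ in a..b, f' φ θ) θ := by
  obtain ⟨M, hM⟩ := ((isCompact_uIcc (a := a) (b := b)).prod
    (isCompact_Icc (a := θ - 1) (b := θ + 1))).exists_bound_of_continuousOn hf'.continuousOn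
  refine (intervalIntegral.hasDerivAt_integral_of_dominated_loc_of_deriv_le
    (F := fun θ φ => f φ θ) (F' := fun θ φ => f' φ θ) (bound := fun _ => M)
    (Icc_mem_nhds (by linarith : θ - 1 < θ) (by linarith : θ < θ + 1)) ?_ ?_ ?_ ?_ ?_ ?_).2
  · exact Filter.Eventually.of_forall fun x => Continuous.aestronglyMeasurable (by fun_prop)
  · exact Continuous.intervalIntegrable (by fun_prop) _ _
  · exact Continuous.aestronglyMeasurable (by fun_prop)
  · exact ae_of_all _ fun t ht x hx => hM (t, x) ⟨Set.uIoc_subset_uIcc ht, hx⟩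
  · exact intervalIntegrable_const
  · exact ae_of_all _ fun t _ x _ => h t x

theorem spherical_energy_nonneg {w : ℝ → ℝ → ℝ}
    (hw : ContDiff ℝ (⊤ : ℕ∞) (Function.uncurry w)) (hper : ∀ θ, w (2 * π) θ = w 0 θ)
    (hmean : ∀ θ ∈ Set.Ioo (-(π / 2)) (π / 2), ∫ φ in (0 : ℝ)..2 * π, w φ θ = 0)
    (hcos : ∫ θ in (-(π / 2))..π / 2, cos θ ^ 3 * ∫ φ in (0 : ℝ)..2 * π, w φ θ * cos φ = 0)
    (hsin : ∫ θ in (-(π / 2))..π / 2, cos θ ^ 3 * ∫ φ in (0 : ℝ)..2 * π, w φ θ * sin φ = 0) :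
    0 ≤ ∫ θ in (-(π / 2))..π / 2, ∫ φ in (0 : ℝ)..2 * π,
      cos θ * ((cos θ * dLat w φ θ - sin θ * w φ θ) ^ 2 + dLon w φ θ ^ 2
        - 6 * cos θ ^ 2 * w φ θ ^ 2) := by
  have hpi := Real.pi_pos
  have hle : -(π / 2) ≤ π / 2 := by linarith
  have cw : Continuous (Function.uncurry w) := hw.continuous
  have cw₁ : Continuous (Function.uncurry (dLon w)) := hw.dLon.continuous
  have cw₂ : Continuous (Function.uncurry (dLat w)) := hw.dLat.continuous
  have hdiv := integral_divergence_eq_zero_s3 (N₁ := fun _ _ => 0) (n₁ := fun _ _ => 0)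
    (N₂ := fun φ θ => -2 * (sin θ * cos θ ^ 2) * w φ θ ^ 2)
    (n₂ := fun φ θ => (-2 * cos θ ^ 3 + 4 * sin θ ^ 2 * cos θ) * w φ θ ^ 2
      - 4 * sin θ * cos θ ^ 2 * w φ θ * dLat w φ θ)
    (t := fun φ θ => (-2 * cos θ ^ 3 + 4 * sin θ ^ 2 * cos θ) * w φ θ ^ 2
      - 4 * sin θ * cos θ ^ 2 * w φ θ * dLat w φ θ)
    (fun φ θ => hasDerivAt_const _ _)
    (fun φ θ => by
      have h := (((hasDerivAt_sin θ).fun_mul ((hasDerivAt_cos θ).fun_pow 2)).const_mul (-2)).fun_mul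
        ((hasDerivAt_dLat hw φ θ).fun_pow 2)
      refine h.congr_deriv ?_
      push_cast
      ring)
    (by fun_prop) (by fun_prop) (by simp) (by simp) (by simp)
  have hsplit : (∫ θ in (-(π / 2))..π / 2, ∫ φ in (0 : ℝ)..2 * π,
      cos θ * ((cos θ * dLat w φ θ - sin θ * w φ θ) ^ 2 + dLon w φ θ ^ 2
        - 6 * cos θ ^ 2 * w φ θ ^ 2))
      = ∫ θ in (-(π / 2))..π / 2, cos θ * ((∫ φ in (0 : ℝ)..2 * π,
          (cos θ * dLat w φ θ + sin θ * w φ θ) ^ 2) + (∫ φ in (0 : ℝ)..2 * π, dLon w φ θ ^ 2)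
          - 4 * ∫ φ in (0 : ℝ)..2 * π, w φ θ ^ 2) := by
    rw [← sub_eq_zero, ← intervalIntegral.integral_sub]
    · refine Eq.trans ?_ hdiv
      refine intervalIntegral.integral_congr fun θ _ => ?_
      rw [← intervalIntegral.integral_const_mul, ← intervalIntegral.integral_add,
        ← intervalIntegral.integral_sub, ← intervalIntegral.integral_const_mul,
        ← intervalIntegral.integral_sub]
      · refine intervalIntegral.integral_congr fun φ _ => ?_
        linear_combination (-4 * cos θ * w φ θ ^ 2) * sin_sq_add_cos_sq θ
      all_goals exact Continuous.intervalIntegrable (by fun_prop) _ _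
    all_goals exact Continuous.intervalIntegrable (by fun_prop) _ _
  rw [hsplit]
  set c : ℝ → ℝ := fun θ => ∫ φ in (0 : ℝ)..2 * π, w φ θ * cos φ with hc
  set c' : ℝ → ℝ := fun θ => ∫ φ in (0 : ℝ)..2 * π, dLat w φ θ * cos φ with hc'
  set s : ℝ → ℝ := fun θ => ∫ φ in (0 : ℝ)..2 * π, w φ θ * sin φ with hs
  set s' : ℝ → ℝ := fun θ => ∫ φ in (0 : ℝ)..2 * π, dLat w φ θ * sin φ with hs'
  have cc : Continuous c := by fun_prop
  have cc' : Continuous c' := by fun_prop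
  have cs : Continuous s := by fun_prop
  have cs' : Continuous s' := by fun_prop
  have hc_energy := first_mode_energy_nonneg (c := c) (c' := c')
    (hasDerivAt_integral_of_continuous (f := fun φ θ => w φ θ * cos φ)
      (f' := fun φ θ => dLat w φ θ * cos φ) (by fun_prop) (by fun_prop)
      fun φ θ => (hasDerivAt_dLat hw φ θ).mul_const _) cc' hcos
  have hs_energy := first_mode_energy_nonneg (c := s) (c' := s')
    (hasDerivAt_integral_of_continuous (f := fun φ θ => w φ θ * sin φ)
      (f' := fun φ θ => dLat w φ θ * sin φ) (by fun_prop) (by fun_prop)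
      fun φ θ => (hasDerivAt_dLat hw φ θ).mul_const _) cs' hsin
  have hsum := mul_nonneg (one_div_nonneg.2 hpi.le) (add_nonneg hc_energy hs_energy)
  rw [← intervalIntegral.integral_add (Continuous.intervalIntegrable (by fun_prop) _ _)
    (Continuous.intervalIntegrable (by fun_prop) _ _), ← intervalIntegral.integral_const_mul]
    at hsum
  refine hsum.trans (intervalIntegral.integral_mono_on_of_le_Ioo hle
    (Continuous.intervalIntegrable (by fun_prop) _ _)
    (Continuous.intervalIntegrable (by fun_prop) _ _) fun θ hθ => ?_)
  have hcosθ : 0 ≤ cos θ := cos_nonneg_of_mem_Icc (Set.Ioo_subset_Icc_self hθ)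
  have hW := wirtinger_second_mode (f := fun φ => w φ θ) (f' := fun φ => dLon w φ θ)
    (fun φ => hasDerivAt_dLon hw φ θ) (by fun_prop) (hper θ) (hmean θ hθ)
  have hB := bessel_first_mode (f := fun φ => cos θ * dLat w φ θ + sin θ * w φ θ) (by fun_prop)
  have hBc : ∫ φ in (0 : ℝ)..2 * π, (cos θ * dLat w φ θ + sin θ * w φ θ) * cos φ
      = cos θ * c' θ + sin θ * c θ := by
    simp only [hc, hc', ← intervalIntegral.integral_const_mul]
    rw [← intervalIntegral.integral_add (Continuous.intervalIntegrable (by fun_prop) _ _)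
      (Continuous.intervalIntegrable (by fun_prop) _ _)]
    exact intervalIntegral.integral_congr fun φ _ => by ring
  have hBs : ∫ φ in (0 : ℝ)..2 * π, (cos θ * dLat w φ θ + sin θ * w φ θ) * sin φ
      = cos θ * s' θ + sin θ * s θ := by
    simp only [hs, hs', ← intervalIntegral.integral_const_mul]
    rw [← intervalIntegral.integral_add (Continuous.intervalIntegrable (by fun_prop) _ _)
      (Continuous.intervalIntegrable (by fun_prop) _ _)]
    exact intervalIntegral.integral_congr fun φ _ => by ring
  rw [hBc, hBs] at hB
  change _ - 3 / π * (c θ ^ 2 + s θ ^ 2) ≤ _ at hW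
  linear_combination mul_le_mul_of_nonneg_left (add_le_add hW hB) hcosθ

/-- A smooth stream function `P` in longitude-latitude coordinates whose longitudinal derivative
is `cos θ · w` with `w` smooth up to the poles, solving the vorticity equation
`ΔP = F(P) - 2ω sin θ` multiplied by `cos θ`. -/
structure IsStationaryFlow (ω : ℝ) (F : ℝ → ℝ) (P w : ℝ → ℝ → ℝ) : Prop where
  smooth : ContDiff ℝ (⊤ : ℕ∞) (Function.uncurry P)
  smooth_lon : ContDiff ℝ (⊤ : ℕ∞) (Function.uncurry w)
  periodic : ∀ θ, Function.Periodic (fun φ => P φ θ) (2 * π)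
  periodic_lon : ∀ θ, Function.Periodic (fun φ => w φ θ) (2 * π)
  hasDerivAt_lon : ∀ φ θ, HasDerivAt (fun s => P s θ) (cos θ * w φ θ) φ
  equation : ∀ φ, ∀ θ ∈ Set.Icc (-(π / 2)) (π / 2),
    cos θ * dLat (dLat P) φ θ - sin θ * dLat P φ θ + dLon w φ θ
      - cos θ * F (P φ θ) + 2 * ω * sin θ * cos θ = 0

theorem dLon_periodic {f : ℝ → ℝ → ℝ} {θ : ℝ} (h : Function.Periodic (fun φ => f φ θ) (2 * π)) :
    Function.Periodic (fun φ => dLon f φ θ) (2 * π) := fun φ => by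
  have : (fun s => f (s + 2 * π) θ) = fun s => f s θ := funext h
  simp only [dLon, ← deriv_comp_add_const, this]

theorem dLat_periodic {f : ℝ → ℝ → ℝ} (h : ∀ θ, Function.Periodic (fun φ => f φ θ) (2 * π))
    (θ : ℝ) : Function.Periodic (fun φ => dLat f φ θ) (2 * π) := fun φ => by
  have : f (φ + 2 * π) = f φ := funext fun s => h s φ
  simp only [dLat, this]

namespace IsStationaryFlow

variable {ω : ℝ} {F : ℝ → ℝ} {P w : ℝ → ℝ → ℝ}

theorem dLon_eq (h : IsStationaryFlow ω F P w) : dLon P = fun φ θ => cos θ * w φ θ :=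
  funext₂ fun φ θ => (h.hasDerivAt_lon φ θ).deriv

theorem dLon_dLat_eq (h : IsStationaryFlow ω F P w) (φ θ : ℝ) :
    dLon (dLat P) φ θ = cos θ * dLat w φ θ - sin θ * w φ θ := by
  rw [dLon_dLat_comm h.smooth, h.dLon_eq, dLat,
    ((hasDerivAt_cos θ).fun_mul (hasDerivAt_dLat h.smooth_lon φ θ)).deriv]
  ring

theorem first_moment_eq_zero (h : IsStationaryFlow ω F P w) (hω : ω ≠ 0) (hF : Continuous F)
    (α : ℝ) :
    ∫ θ in (-(π / 2))..π / 2, cos θ ^ 3 * ∫ φ in (0 : ℝ)..2 * π, w φ θ * sin (φ + α) = 0 := by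
  have hP := h.smooth
  have hw := h.smooth_lon
  have cP : Continuous (Function.uncurry P) := hP.continuous
  have cp : Continuous (Function.uncurry (dLat P)) := hP.dLat.continuous
  have cpt : Continuous (Function.uncurry (dLat (dLat P))) := hP.dLat.dLat.continuous
  have cq : Continuous (Function.uncurry (dLon (dLat P))) := hP.dLat.dLon.continuous
  have cw : Continuous (Function.uncurry w) := hw.continuous
  have cw₁ : Continuous (Function.uncurry (dLon w)) := hw.dLon.continuous
  have cw₂ : Continuous (Function.uncurry (dLat w)) := hw.dLat.continuous
  set G : ℝ → ℝ := fun y => ∫ s in (0 : ℝ)..y, F s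
  have hG : ∀ y, HasDerivAt G (F y) y := fun y => (hF.integral_hasStrictDerivAt 0 y).hasDerivAt
  have cG : Continuous G := continuous_iff_continuousAt.2 fun y => (hG y).continuousAt
  have dS : ∀ φ, HasDerivAt (fun s => sin (s + α)) (cos (φ + α)) φ := fun φ =>
    (hasDerivAt_sin (φ + α)).comp_add_const φ α
  have dC : ∀ φ, HasDerivAt (fun s => cos (s + α)) (-sin (φ + α)) φ := fun φ =>
    (hasDerivAt_cos (φ + α)).comp_add_const φ α
  have key := integral_divergence_eq_zero_s3
    (N₁ := fun φ θ => (cos (φ + α) * dLat P φ θ + sin θ * (sin (φ + α) * w φ θ)) * w φ θ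
      - sin θ / 2 * (sin (φ + α) * (dLat P φ θ ^ 2 + w φ θ ^ 2))
      - sin θ * (sin (φ + α) * G (P φ θ))
      + 2 * ω * (sin θ ^ 2 - cos θ ^ 2) * (sin (φ + α) * P φ θ))
    (n₁ := fun φ θ => (-sin (φ + α) * dLat P φ θ + cos (φ + α) * dLon (dLat P) φ θ
          + sin θ * (cos (φ + α) * w φ θ + sin (φ + α) * dLon w φ θ)) * w φ θ
        + (cos (φ + α) * dLat P φ θ + sin θ * (sin (φ + α) * w φ θ)) * dLon w φ θ
      - sin θ / 2 * (cos (φ + α) * (dLat P φ θ ^ 2 + w φ θ ^ 2)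
        + sin (φ + α) * (2 * dLat P φ θ * dLon (dLat P) φ θ + 2 * w φ θ * dLon w φ θ))
      - sin θ * (cos (φ + α) * G (P φ θ) + sin (φ + α) * (F (P φ θ) * (cos θ * w φ θ)))
      + 2 * ω * (sin θ ^ 2 - cos θ ^ 2)
        * (cos (φ + α) * P φ θ + sin (φ + α) * (cos θ * w φ θ)))
    (N₂ := fun φ θ => cos θ * ((cos (φ + α) * dLat P φ θ + sin (φ + α) * (sin θ * w φ θ))
        * dLat P φ θ - cos (φ + α) / 2 * (dLat P φ θ ^ 2 + w φ θ ^ 2)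
        - cos (φ + α) * G (P φ θ) + 2 * ω * cos (φ + α) * (sin θ * P φ θ)))
    (n₂ := fun φ θ => -sin θ * ((cos (φ + α) * dLat P φ θ + sin (φ + α) * (sin θ * w φ θ))
        * dLat P φ θ - cos (φ + α) / 2 * (dLat P φ θ ^ 2 + w φ θ ^ 2)
        - cos (φ + α) * G (P φ θ) + 2 * ω * cos (φ + α) * (sin θ * P φ θ))
      + cos θ * ((cos (φ + α) * dLat (dLat P) φ θ
            + sin (φ + α) * (cos θ * w φ θ + sin θ * dLat w φ θ)) * dLat P φ θ
          + (cos (φ + α) * dLat P φ θ + sin (φ + α) * (sin θ * w φ θ)) * dLat (dLat P) φ θ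
        - cos (φ + α) / 2 * (2 * dLat P φ θ * dLat (dLat P) φ θ + 2 * w φ θ * dLat w φ θ)
        - cos (φ + α) * (F (P φ θ) * dLat P φ θ)
        + 2 * ω * cos (φ + α) * (cos θ * P φ θ + sin θ * dLat P φ θ)))
    (t := fun φ θ => -2 * ω * (cos θ ^ 3 * (w φ θ * sin (φ + α))))
    (fun φ θ => by
      have dP := h.hasDerivAt_lon φ θ
      have dp := hasDerivAt_dLon hP.dLat φ θ
      have dw := hasDerivAt_dLon hw φ θ
      have hd := (((((((dC φ).fun_mul dp).fun_add
        (((dS φ).fun_mul dw).const_mul (sin θ))).fun_mul dw).fun_sub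
        (((dS φ).fun_mul ((dp.fun_pow 2).fun_add (dw.fun_pow 2))).const_mul (sin θ / 2))).fun_sub
        (((dS φ).fun_mul ((hG (P φ θ)).comp φ dP)).const_mul (sin θ))).fun_add
        (((dS φ).fun_mul dP).const_mul (2 * ω * (sin θ ^ 2 - cos θ ^ 2))))
      refine hd.congr_deriv ?_
      simp only [Function.comp_apply]
      push_cast
      ring)
    (fun φ θ => by
      have dP := hasDerivAt_dLat hP φ θ
      have dp := hasDerivAt_dLat hP.dLat φ θ
      have dw := hasDerivAt_dLat hw φ θ
      have hs := hasDerivAt_sin θ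
      have hd := (hasDerivAt_cos θ).fun_mul ((((((dp.const_mul (cos (φ + α))).fun_add
        ((hs.fun_mul dw).const_mul (sin (φ + α)))).fun_mul dp).fun_sub
        (((dp.fun_pow 2).fun_add (dw.fun_pow 2)).const_mul (cos (φ + α) / 2))).fun_sub
        (((hG (P φ θ)).comp θ dP).const_mul (cos (φ + α)))).fun_add
        ((hs.fun_mul dP).const_mul (2 * ω * cos (φ + α))))
      refine hd.congr_deriv ?_
      simp only [Function.comp_apply]
      push_cast
      ring)
    (by fun_prop) (by fun_prop)
    (fun θ => by
      have e₁ : P (2 * π) θ = P 0 θ := by simpa using h.periodic θ 0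
      have e₂ : dLat P (2 * π) θ = dLat P 0 θ := by simpa using dLat_periodic h.periodic θ 0
      have e₃ : w (2 * π) θ = w 0 θ := by simpa using h.periodic_lon θ 0
      have e₄ : sin (2 * π + α) = sin (0 + α) := by rw [add_comm, sin_add_two_pi, zero_add]
      have e₅ : cos (2 * π + α) = cos (0 + α) := by rw [add_comm, cos_add_two_pi, zero_add]
      simp only [e₁, e₂, e₃, e₄, e₅])
    (fun φ => by simp)
    (fun φ θ hθ => by
      have hE := h.equation φ θ hθ
      simp only [h.dLon_dLat_eq φ θ]
      linear_combination
        (cos (φ + α) * dLat P φ θ + sin θ * (sin (φ + α) * w φ θ)) * hE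
          + sin (φ + α) * dLat P φ θ * w φ θ * sin_sq_add_cos_sq θ)
  simp only [intervalIntegral.integral_const_mul] at key
  exact (mul_eq_zero.1 key).resolve_left (by simpa using hω)

theorem energy_identity (h : IsStationaryFlow ω F P w) (hF : ContDiff ℝ 1 F) :
    ∫ θ in (-(π / 2))..π / 2, ∫ φ in (0 : ℝ)..2 * π,
      cos θ * ((cos θ * dLat w φ θ - sin θ * w φ θ) ^ 2 + dLon w φ θ ^ 2
        + deriv F (P φ θ) * cos θ ^ 2 * w φ θ ^ 2) = 0 := by
  have hP := h.smooth
  have hw := h.smooth_lon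
  have cq : Continuous (Function.uncurry (dLon (dLat P))) := hP.dLat.dLon.continuous
  have cqt : Continuous (Function.uncurry (dLat (dLon (dLat P)))) := hP.dLat.dLon.dLat.continuous
  have cw : Continuous (Function.uncurry w) := hw.continuous
  have cw₁ : Continuous (Function.uncurry (dLon w)) := hw.dLon.continuous
  have cw₁₁ : Continuous (Function.uncurry (dLon (dLon w))) := hw.dLon.dLon.continuous
  have cw₂ : Continuous (Function.uncurry (dLat w)) := hw.dLat.continuous
  refine integral_divergence_eq_zero_s3
    (N₁ := fun φ θ => cos θ * (w φ θ * dLon w φ θ))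
    (n₁ := fun φ θ => cos θ * (dLon w φ θ * dLon w φ θ + w φ θ * dLon (dLon w) φ θ))
    (N₂ := fun φ θ => cos θ * (dLon (dLat P) φ θ * (cos θ * w φ θ)))
    (n₂ := fun φ θ => -sin θ * (dLon (dLat P) φ θ * (cos θ * w φ θ))
      + cos θ * (dLat (dLon (dLat P)) φ θ * (cos θ * w φ θ)
        + dLon (dLat P) φ θ * (-sin θ * w φ θ + cos θ * dLat w φ θ)))
    (fun φ θ => ((hasDerivAt_dLon hw φ θ).fun_mul (hasDerivAt_dLon hw.dLon φ θ)).const_mul _)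
    (fun φ θ => (hasDerivAt_cos θ).fun_mul ((hasDerivAt_dLat hP.dLat.dLon φ θ).fun_mul
      ((hasDerivAt_cos θ).fun_mul (hasDerivAt_dLat hw φ θ))))
    (by fun_prop) (by fun_prop)
    (fun θ => by
      have e₁ : w (2 * π) θ = w 0 θ := by simpa using h.periodic_lon θ 0
      have e₂ : dLon w (2 * π) θ = dLon w 0 θ := by
        simpa using dLon_periodic (h.periodic_lon θ) 0
      simp only [e₁, e₂])
    (fun φ => by simp)
    (fun φ θ hθ => ?_)
  have hFd : HasDerivAt F (deriv F (P φ θ)) (P φ θ) :=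
    (hF.differentiable one_ne_zero _).hasDerivAt
  have hd := (((((hasDerivAt_dLon hP.dLat.dLat φ θ).const_mul (cos θ)).fun_sub
    ((hasDerivAt_dLon hP.dLat φ θ).const_mul (sin θ))).fun_add
    (hasDerivAt_dLon hw.dLon φ θ)).fun_sub
    ((hFd.comp φ (h.hasDerivAt_lon φ θ)).const_mul (cos θ))).add_const
    (2 * ω * sin θ * cos θ)
  have hzero := hd.unique (((hasDerivAt_const φ (0 : ℝ)).congr_of_eventuallyEq
    (Filter.Eventually.of_forall fun s => h.equation s θ hθ)))
  rw [dLon_dLat_comm hP.dLat] at hzero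
  have hq := h.dLon_dLat_eq φ θ
  rw [← hq]
  linear_combination cos θ * w φ θ * hzero - cos θ * dLon (dLat P) φ θ * hq

theorem lon_eq_zero (h : IsStationaryFlow ω F P w) (hω : ω ≠ 0) (hF : ContDiff ℝ 1 F)
    (hF' : ∀ s, deriv F s > -6) (φ : ℝ) {θ : ℝ} (hθ : θ ∈ Set.Ioo (-(π / 2)) (π / 2)) :
    w φ θ = 0 := by
  have hpi := Real.pi_pos
  have cF : Continuous (deriv F) := hF.continuous_deriv le_rfl
  have cP : Continuous (Function.uncurry P) := h.smooth.continuous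
  have cw : Continuous (Function.uncurry w) := h.smooth_lon.continuous
  have cw₁ : Continuous (Function.uncurry (dLon w)) := h.smooth_lon.dLon.continuous
  have cw₂ : Continuous (Function.uncurry (dLat w)) := h.smooth_lon.dLat.continuous
  have hmean : ∀ θ ∈ Set.Ioo (-(π / 2)) (π / 2), ∫ φ in (0 : ℝ)..2 * π, w φ θ = 0 := by
    intro θ hθ
    have e : P (2 * π) θ = P 0 θ := by simpa using h.periodic θ 0
    have := intervalIntegral.integral_eq_sub_of_hasDerivAt (a := 0) (b := 2 * π)
      (fun φ _ => h.hasDerivAt_lon φ θ) (Continuous.intervalIntegrable (by fun_prop) _ _)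
    rw [e, sub_self, intervalIntegral.integral_const_mul] at this
    exact (mul_eq_zero.1 this).resolve_left (cos_pos_of_mem_Ioo hθ).ne'
  have hE := spherical_energy_nonneg h.smooth_lon
    (fun θ => by simpa using h.periodic_lon θ 0) hmean
    (by simpa [sin_add_pi_div_two] using h.first_moment_eq_zero hω hF.continuous (π / 2))
    (by simpa using h.first_moment_eq_zero hω hF.continuous 0)
  set D : ℝ → ℝ → ℝ := fun φ θ => cos θ ^ 3 * (deriv F (P φ θ) + 6) * w φ θ ^ 2 with hD
  have cD : Continuous (Function.uncurry D) := by fun_prop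
  have hDnn : ∀ φ, ∀ θ ∈ Set.Icc (-(π / 2)) (π / 2), 0 ≤ D φ θ := fun φ θ hθ =>
    mul_nonneg (mul_nonneg (pow_nonneg (cos_nonneg_of_mem_Icc hθ) 3)
      (by linarith [hF' (P φ θ)])) (sq_nonneg _)
  have hDint : ∫ θ in (-(π / 2))..π / 2, ∫ φ in (0 : ℝ)..2 * π, D φ θ ≤ 0 := by
    have hsub := sub_nonpos.2 ((h.energy_identity hF).trans_le hE)
    rw [← intervalIntegral.integral_sub (Continuous.intervalIntegrable (by fun_prop) _ _)
      (Continuous.intervalIntegrable (by fun_prop) _ _)] at hsub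
    refine (intervalIntegral.integral_congr fun θ _ => ?_).trans_le hsub
    rw [← intervalIntegral.integral_sub (Continuous.intervalIntegrable (by fun_prop) _ _)
      (Continuous.intervalIntegrable (by fun_prop) _ _)]
    refine intervalIntegral.integral_congr fun φ _ => ?_
    simp only [hD]
    ring
  by_contra hne
  obtain ⟨ψ, hψ, hψw⟩ := (h.periodic_lon θ).exists_mem_Ico₀ Real.two_pi_pos φ
  have hDpos : 0 < D ψ θ := by
    have : w ψ θ ≠ 0 := fun h0 => hne (hψw.trans h0)
    have := cos_pos_of_mem_Ioo hθ
    have := hF' (P ψ θ)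
    have : 0 < deriv F (P ψ θ) + 6 := by linarith
    positivity
  have hinner : 0 < ∫ φ in (0 : ℝ)..2 * π, D φ θ :=
    intervalIntegral.integral_pos Real.two_pi_pos (Continuous.continuousOn (by fun_prop))
      (fun s _ => hDnn s θ (Set.Ioo_subset_Icc_self hθ)) ⟨ψ, Set.Ico_subset_Icc_self hψ, hDpos⟩
  refine hDint.not_gt (intervalIntegral.integral_pos (by linarith)
    (Continuous.continuousOn (by fun_prop)) (fun s hs => ?_)
    ⟨θ, Set.Ioo_subset_Icc_self hθ, hinner⟩)
  exact intervalIntegral.integral_nonneg Real.two_pi_pos.le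
    fun φ _ => hDnn φ s (Set.Ioc_subset_Icc_self hs)

end IsStationaryFlow

theorem sphRep_isStationaryFlow {ω : ℝ} {ψ : ℝ × ℝ × ℝ → ℝ} {F : ℝ → ℝ}
    (hψ : ContDiff ℝ (⊤ : ℕ∞) ψ) (hF : Continuous F)
    (heq : ∀ φ θ : ℝ, θ ∈ Set.Ioo (-(π / 2)) (π / 2) →
      LB (sphRep ψ) φ θ = F (sphRep ψ φ θ) - 2 * ω * Real.sin θ) :
    IsStationaryFlow ω F (sphRep ψ)
      (fun φ θ => fderiv ℝ ψ (sphPt φ θ) (-sin φ, cos φ, 0)) := by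
  have hpt : ContDiff ℝ (⊤ : ℕ∞) (fun x : ℝ × ℝ => sphPt x.1 x.2) := by
    unfold sphPt
    fun_prop
  have hP : ContDiff ℝ (⊤ : ℕ∞) (Function.uncurry (sphRep ψ)) := hψ.comp hpt
  have hw : ContDiff ℝ (⊤ : ℕ∞)
      (Function.uncurry fun φ θ => fderiv ℝ ψ (sphPt φ θ) (-sin φ, cos φ, 0)) :=
    ((hψ.fderiv_right (m := (⊤ : ℕ∞)) (by simp)).comp hpt).clm_apply (by fun_prop)
  have hlon : ∀ φ θ, HasDerivAt (fun s => sphRep ψ s θ)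
      (cos θ * fderiv ℝ ψ (sphPt φ θ) (-sin φ, cos φ, 0)) φ := fun φ θ => by
    have h := (hψ.differentiable (by simp) (sphPt φ θ)).hasFDerivAt.comp_hasDerivAt
      (f := fun s => sphPt s θ) φ (((hasDerivAt_cos φ).mul_const (cos θ)).prodMk
        (((hasDerivAt_sin φ).mul_const (cos θ)).prodMk (hasDerivAt_const φ (sin θ))))
    refine h.congr_deriv ?_
    rw [← smul_eq_mul (cos θ) (fderiv _ _ _ _), ← map_smul]
    simp [mul_comm]
  have hpt_per : ∀ φ θ, sphPt (φ + 2 * π) θ = sphPt φ θ := fun φ θ => by simp [sphPt]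
  refine ⟨hP, hw, fun θ φ => ?_, fun θ φ => ?_, hlon, fun φ θ hθ => ?_⟩
  · simp only [sphRep, hpt_per]
  · simp only [hpt_per, sin_add_two_pi, cos_add_two_pi]
  set w : ℝ → ℝ → ℝ := fun φ θ => fderiv ℝ ψ (sphPt φ θ) (-sin φ, cos φ, 0)
  have hopen : ∀ θ ∈ Set.Ioo (-(π / 2)) (π / 2),
      cos θ * dLat (dLat (sphRep ψ)) φ θ - sin θ * dLat (sphRep ψ) φ θ + dLon w φ θ
        - cos θ * F (sphRep ψ φ θ) + 2 * ω * sin θ * cos θ = 0 := fun θ hθ => by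
    have hc := (cos_pos_of_mem_Ioo hθ).ne'
    have h := heq φ θ hθ
    have hlat : iteratedDeriv 2 (fun s => sphRep ψ φ s) θ = dLat (dLat (sphRep ψ)) φ θ := by
      rw [iteratedDeriv_succ, iteratedDeriv_one]
      rfl
    have hlon₂ : iteratedDeriv 2 (fun s => sphRep ψ s θ) φ = cos θ * dLon w φ θ := by
      rw [iteratedDeriv_succ, iteratedDeriv_one, funext fun s => (hlon s θ).deriv]
      exact ((hasDerivAt_dLon hw φ θ).const_mul _).deriv
    rw [LB, hlat, hlon₂, tan_eq_sin_div_cos] at h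
    change _ - _ * dLat (sphRep ψ) φ θ + _ = _ at h
    field_simp at h
    linear_combination h
  have hcont : Continuous fun θ => cos θ * dLat (dLat (sphRep ψ)) φ θ
      - sin θ * dLat (sphRep ψ) φ θ + dLon w φ θ
        - cos θ * F (sphRep ψ φ θ) + 2 * ω * sin θ * cos θ := by
    have c₀ := hP.continuous
    have c₁ := hP.dLat.continuous
    have c₂ := hP.dLat.dLat.continuous
    have c₃ := hw.dLon.continuous
    fun_prop
  have hcl := Set.EqOn.closure (f := fun θ => cos θ * dLat (dLat (sphRep ψ)) φ θ
      - sin θ * dLat (sphRep ψ) φ θ + dLon w φ θ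
        - cos θ * F (sphRep ψ φ θ) + 2 * ω * sin θ * cos θ) (g := fun _ => 0) hopen hcont
      continuous_const
  rw [closure_Ioo (by linarith [Real.pi_pos])] at hcl
  exact hcl hθ

theorem exists_sphPt_eq {x : ℝ × ℝ × ℝ} (hx : x.1 ^ 2 + x.2.1 ^ 2 + x.2.2 ^ 2 = 1) :
    ∃ φ, x = sphPt φ (arcsin x.2.2) := by
  obtain ⟨a, b, c⟩ := x
  simp only at hx
  have hc : -1 ≤ c ∧ c ≤ 1 := abs_le.1 (abs_le_one_iff_mul_self_le_one.2 (by nlinarith))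
  have hr : √(1 - c ^ 2) = ‖(⟨a, b⟩ : ℂ)‖ := by
    rw [Complex.norm_def, Complex.normSq_mk]
    congr 1
    linarith
  refine ⟨Complex.arg ⟨a, b⟩, ?_⟩
  have h₁ := Complex.norm_mul_cos_arg ⟨a, b⟩
  have h₂ := Complex.norm_mul_sin_arg ⟨a, b⟩
  simp only [sphPt, cos_arcsin, sin_arcsin hc.1 hc.2, hr, Prod.mk.injEq, and_true]
  exact ⟨by rw [mul_comm, h₁], by rw [mul_comm, h₂]⟩

/-- For `ω ≠ 0`, if `F' > −6` everywhere and the spherical representation of the smooth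
function `ψ` satisfies `ΔΨ = F(Ψ) − 2ω sin θ`, then `ψ` is zonal: on the unit sphere,
`ψ x = g x₃` for some `g : ℝ → ℝ`. -/
theorem rigidity_zonal_rotating (ω : ℝ) (hω : ω ≠ 0)
    (ψ : ℝ × ℝ × ℝ → ℝ) (F : ℝ → ℝ)
    (hψ : ContDiff ℝ (⊤ : ℕ∞) ψ) (hF : ContDiff ℝ 1 F)
    (hF' : ∀ s : ℝ, deriv F s > -6)
    (heq : ∀ φ θ : ℝ, θ ∈ Set.Ioo (-(π/2)) (π/2) →
      LB (sphRep ψ) φ θ = F (sphRep ψ φ θ) - 2 * ω * Real.sin θ) :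
    ∃ g : ℝ → ℝ, ∀ x : ℝ × ℝ × ℝ, x.1 ^ 2 + x.2.1 ^ 2 + x.2.2 ^ 2 = 1 →
      ψ x = g x.2.2 := by
  have hflow := sphRep_isStationaryFlow hψ hF.continuous heq
  refine ⟨fun t => sphRep ψ 0 (arcsin t), fun x hx => ?_⟩
  obtain ⟨φ, hφ⟩ := exists_sphPt_eq hx
  have hconst : ∀ s, deriv (fun s => sphRep ψ s (arcsin x.2.2)) s = 0 := fun s => by
    rw [(hflow.hasDerivAt_lon s _).deriv]
    by_cases hc : cos (arcsin x.2.2) = 0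
    · rw [hc, zero_mul]
    · have hθ : arcsin x.2.2 ∈ Set.Ioo (-(π / 2)) (π / 2) := by
        refine ⟨(neg_pi_div_two_le_arcsin _).lt_of_ne fun h => hc ?_,
          (arcsin_le_pi_div_two _).lt_of_ne fun h => hc ?_⟩
        · rw [← h, cos_neg, cos_pi_div_two]
        · rw [h, cos_pi_div_two]
      rw [hflow.lon_eq_zero hω hF hF' s hθ, mul_zero]
  have := is_const_of_deriv_eq_zero
    (fun s => (hflow.hasDerivAt_lon s (arcsin x.2.2)).differentiableAt) hconst φ 0
  conv_lhs => rw [hφ]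
  exact this
end
end
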